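/- For 0 < t < 1 define f(t) = √((1+t)(3−t))/2 and β(t) = ((1+f(t))/(2f(t)))·ln((1+f(t))/(2f(t))) − ((1−f(t))/(2f(t)))·ln((1−f(t))/(2f(t))). Then for every t ∈ (0, 1) and every ε > 0 there exists n₀ such that for all n ≥ n₀ the following holds: if A is a finite set of nonzero vectors in Euclidean space ℝⁿ such that ‖u − v‖² ≥ (1 + t)·max(‖u‖², ‖v‖²) for all distinct u, v ∈ A, then #A ≤ e^{(β(t) + ε)·n}. -/

import Mathlib

/-- `f(t) = √((1+t)(3−t))/2`. -/
noncomputable def klSine (t : ℝ) : ℝ := Real.sqrt ((1 + t) * (3 - t)) / 2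

/-- The Kabatiansky–Levenstein exponent (natural logarithm version)
`β(t) = ((1+f)/(2f))·ln((1+f)/(2f)) − ((1−f)/(2f))·ln((1−f)/(2f))` with `f = f(t)`. -/
noncomputable def klBeta (t : ℝ) : ℝ :=
  ((1 + klSine t) / (2 * klSine t)) * Real.log ((1 + klSine t) / (2 * klSine t)) -
    ((1 - klSine t) / (2 * klSine t)) * Real.log ((1 - klSine t) / (2 * klSine t))

/-- Fischer weight. -/
noncomputable def klW {n : ℕ} (α : Fin n →₀ ℕ) : ℝ := ∏ i, ((α i).factorial : ℝ)

/-- Fischer bilinear form. -/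
noncomputable def klB (n : ℕ) :
    MvPolynomial (Fin n) ℝ →ₗ[ℝ] MvPolynomial (Fin n) ℝ →ₗ[ℝ] ℝ :=
  (MvPolynomial.basisMonomials (Fin n) ℝ).constr ℝ
    (fun α => klW α • MvPolynomial.lcoeff ℝ α)

theorem klB_monomial {n : ℕ} (α : Fin n →₀ ℕ) (a : ℝ) (q : MvPolynomial (Fin n) ℝ) :
    klB n (MvPolynomial.monomial α a) q = a * klW α * q.coeff α := by
  have h : (MvPolynomial.monomial α a : MvPolynomial (Fin n) ℝ)
      = a • (MvPolynomial.basisMonomials (Fin n) ℝ) α := by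
    simp [MvPolynomial.smul_monomial]
  rw [h, map_smul]
  unfold klB
  rw [Module.Basis.constr_basis]
  simp [mul_assoc]

theorem klW_pos {n : ℕ} (α : Fin n →₀ ℕ) : 0 < klW α := by
  unfold klW
  exact Finset.prod_pos fun i _ => by positivity

theorem klW_add_single {n : ℕ} (α : Fin n →₀ ℕ) (i : Fin n) :
    klW (α + Finsupp.single i 1) = klW α * (α i + 1) := by
  unfold klW
  rw [← Finset.mul_prod_erase _ _ (Finset.mem_univ i),
    ← Finset.mul_prod_erase _ (fun j => ((α j).factorial : ℝ)) (Finset.mem_univ i)]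
  have : ∏ x ∈ Finset.univ.erase i, (((α + Finsupp.single i 1 : Fin n →₀ ℕ) x).factorial : ℝ)
      = ∏ x ∈ Finset.univ.erase i, ((α x).factorial : ℝ) := by
    refine Finset.prod_congr rfl fun j hj => ?_
    have : i ≠ j := fun h => by simp [h] at hj
    simp [Finsupp.single_apply, this]
  rw [this]
  simp [Nat.factorial_succ]
  ring

theorem klB_X_mul {n : ℕ} (i : Fin n) (p q : MvPolynomial (Fin n) ℝ) :
    klB n (MvPolynomial.X i * p) q = klB n p (MvPolynomial.pderiv i q) := by
  induction p using MvPolynomial.induction_on' with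
  | monomial α a =>
    rw [show (MvPolynomial.X i : MvPolynomial (Fin n) ℝ) * MvPolynomial.monomial α a
      = MvPolynomial.monomial (α + Finsupp.single i 1) a by
        rw [MvPolynomial.X, MvPolynomial.monomial_mul, one_mul, add_comm]]
    rw [klB_monomial, klB_monomial, MvPolynomial.coeff_pderiv, klW_add_single]
    ring
  | add p q hp hq => simp [mul_add, hp, hq]

theorem klB_symm {n : ℕ} (p q : MvPolynomial (Fin n) ℝ) : klB n p q = klB n q p := by
  induction p using MvPolynomial.induction_on' with
  | monomial α a =>
    induction q using MvPolynomial.induction_on' with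
    | monomial β b =>
      classical
      simp only [klB_monomial, MvPolynomial.coeff_monomial]
      by_cases h : α = β
      · subst h; simp; ring
      · simp [h, Ne.symm h]
    | add p q hp hq => simp [hp, hq]
  | add p q hp hq => simp [hp, hq]

/-- linear form. -/
noncomputable def klE {n : ℕ} (x : Fin n → ℝ) : MvPolynomial (Fin n) ℝ :=
  ∑ i, MvPolynomial.C (x i) * MvPolynomial.X i

noncomputable def klN (n : ℕ) : MvPolynomial (Fin n) ℝ :=
  ∑ i, MvPolynomial.X i * MvPolynomial.X i

noncomputable def klD {n : ℕ} (x : Fin n → ℝ) (p : MvPolynomial (Fin n) ℝ) :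
    MvPolynomial (Fin n) ℝ :=
  ∑ i, MvPolynomial.C (x i) * MvPolynomial.pderiv i p

noncomputable def klL {n : ℕ} (p : MvPolynomial (Fin n) ℝ) : MvPolynomial (Fin n) ℝ :=
  ∑ i, MvPolynomial.pderiv i (MvPolynomial.pderiv i p)

theorem klB_E_mul {n : ℕ} (x : Fin n → ℝ) (p q : MvPolynomial (Fin n) ℝ) :
    klB n (klE x * p) q = klB n p (klD x q) := by
  unfold klE klD
  rw [Finset.sum_mul, map_sum, map_sum, LinearMap.sum_apply]
  refine Finset.sum_congr rfl fun i _ => ?_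
  rw [mul_assoc, ← MvPolynomial.smul_eq_C_mul, ← MvPolynomial.smul_eq_C_mul, map_smul, map_smul,
    LinearMap.smul_apply, klB_X_mul]

theorem klB_N_mul {n : ℕ} (p q : MvPolynomial (Fin n) ℝ) :
    klB n (klN n * p) q = klB n p (klL q) := by
  unfold klN klL
  rw [Finset.sum_mul, map_sum, map_sum, LinearMap.sum_apply]
  refine Finset.sum_congr rfl fun i _ => ?_
  rw [mul_assoc, klB_X_mul, klB_X_mul]

theorem pderiv_klE {n : ℕ} (x : Fin n → ℝ) (i : Fin n) :
    MvPolynomial.pderiv i (klE x) = MvPolynomial.C (x i) := by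
  classical
  unfold klE
  simp [map_sum, MvPolynomial.pderiv_mul, MvPolynomial.pderiv_X, Pi.single_apply]

theorem pderiv_klN {n : ℕ} (i : Fin n) :
    MvPolynomial.pderiv i (klN n) = 2 * MvPolynomial.X i := by
  classical
  unfold klN
  simp [map_sum, MvPolynomial.pderiv_mul, MvPolynomial.pderiv_X, Pi.single_apply,
    Finset.sum_add_distrib]
  ring

theorem klD_sub {n : ℕ} (x : Fin n → ℝ) (p q : MvPolynomial (Fin n) ℝ) :
    klD x (p - q) = klD x p - klD x q := by
  simp [klD, mul_sub, Finset.sum_sub_distrib]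

theorem klL_sub {n : ℕ} (p q : MvPolynomial (Fin n) ℝ) :
    klL (p - q) = klL p - klL q := by
  simp [klL, Finset.sum_sub_distrib]

theorem klD_C_mul {n : ℕ} (x : Fin n → ℝ) (a : ℝ) (p : MvPolynomial (Fin n) ℝ) :
    klD x (MvPolynomial.C a * p) = MvPolynomial.C a * klD x p := by
  simp only [klD, MvPolynomial.pderiv_mul, MvPolynomial.pderiv_C, zero_mul, zero_add,
    Finset.mul_sum]
  exact Finset.sum_congr rfl fun i _ => by ring

theorem klL_C_mul {n : ℕ} (a : ℝ) (p : MvPolynomial (Fin n) ℝ) :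
    klL (MvPolynomial.C a * p) = MvPolynomial.C a * klL p := by
  simp only [klL, MvPolynomial.pderiv_mul, MvPolynomial.pderiv_C, zero_mul, zero_add,
    Finset.mul_sum]

theorem klD_mul {n : ℕ} (x : Fin n → ℝ) (p q : MvPolynomial (Fin n) ℝ) :
    klD x (p * q) = klD x p * q + p * klD x q := by
  simp only [klD, MvPolynomial.pderiv_mul, Finset.sum_mul, Finset.mul_sum,
    ← Finset.sum_add_distrib]
  exact Finset.sum_congr rfl fun i _ => by ring

theorem klD_E {n : ℕ} (x y : Fin n → ℝ) :
    klD x (klE y) = MvPolynomial.C (∑ i, x i * y i) := by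
  simp [klD, pderiv_klE]

theorem klD_N {n : ℕ} (x : Fin n → ℝ) : klD x (klN n) = 2 * klE x := by
  simp only [klD, pderiv_klN, klE, Finset.mul_sum]
  exact Finset.sum_congr rfl fun i _ => by ring

theorem klL_E_mul {n : ℕ} (x : Fin n → ℝ) (p : MvPolynomial (Fin n) ℝ) :
    klL (klE x * p) = klE x * klL p + 2 * klD x p := by
  simp only [klL, klD, MvPolynomial.pderiv_mul, pderiv_klE, map_add, MvPolynomial.pderiv_C,
    Finset.mul_sum, ← Finset.sum_add_distrib]
  exact Finset.sum_congr rfl fun i _ => by ring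

theorem klL_N_mul {n : ℕ} (p : MvPolynomial (Fin n) ℝ) (k : ℕ) (hp : p.IsHomogeneous k) :
    klL (klN n * p) = klN n * klL p + MvPolynomial.C (2 * n + 4 * k : ℝ) * p := by
  have h := hp.sum_X_mul_pderiv
  have h2 : MvPolynomial.C (2 * n + 4 * k : ℝ) * p =
      ∑ i : Fin n, (2 * p + 4 * (MvPolynomial.X i * MvPolynomial.pderiv i p)) := by
    rw [Finset.sum_add_distrib, ← Finset.mul_sum, ← Finset.mul_sum, h]
    have hC2 : (MvPolynomial.C (2:ℝ) : MvPolynomial (Fin n) ℝ) = 2 := map_ofNat _ 2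
    have hC4 : (MvPolynomial.C (4:ℝ) : MvPolynomial (Fin n) ℝ) = 4 := map_ofNat _ 4
    simp [nsmul_eq_mul, hC2, hC4]
    ring
  rw [h2]
  simp only [klL, MvPolynomial.pderiv_mul, pderiv_klN, map_add,
    Finset.mul_sum, ← Finset.sum_add_distrib]
  refine Finset.sum_congr rfl fun i _ => ?_
  have h3 : MvPolynomial.pderiv i (2 : MvPolynomial (Fin n) ℝ) = 0 := by
    exact_mod_cast (MvPolynomial.pderiv i).map_natCast 2
  rw [h3, MvPolynomial.pderiv_X_self]
  ring

/-- recurrence coefficients of the monic Gegenbauer polynomials -/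
noncomputable def klb (n : ℕ) (k : ℕ) : ℝ :=
  (k : ℝ) * (k + n - 3) / ((2 * k + n - 2) * (2 * k + n - 4))

noncomputable def klQ {n : ℕ} (x : Fin n → ℝ) : ℕ → MvPolynomial (Fin n) ℝ
  | 0 => 1
  | 1 => klE x
  | (k + 2) => klE x * klQ x (k + 1) - MvPolynomial.C (klb n (k + 1)) * (klN n * klQ x k)

noncomputable def klG (n : ℕ) (u : ℝ) : ℕ → ℝ
  | 0 => 1
  | 1 => u
  | (k + 2) => u * klG n u (k + 1) - klb n (k + 1) * klG n u k

theorem klE_hom {n : ℕ} (x : Fin n → ℝ) : (klE x).IsHomogeneous 1 := by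
  unfold klE
  refine MvPolynomial.IsHomogeneous.sum _ _ _ fun i _ => ?_
  simpa using (MvPolynomial.isHomogeneous_C (Fin n) (x i)).mul (MvPolynomial.isHomogeneous_X ℝ i)

theorem klN_hom (n : ℕ) : (klN n).IsHomogeneous 2 := by
  unfold klN
  refine MvPolynomial.IsHomogeneous.sum _ _ _ fun i _ => ?_
  simpa using (MvPolynomial.isHomogeneous_X ℝ i).mul (MvPolynomial.isHomogeneous_X ℝ i)

theorem klQ_hom {n : ℕ} (x : Fin n → ℝ) (k : ℕ) :
    (klQ x k).IsHomogeneous k ∧ (klQ x (k+1)).IsHomogeneous (k+1) := by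
  induction k with
  | zero => exact ⟨MvPolynomial.isHomogeneous_one _ _, klE_hom x⟩
  | succ k ih =>
    refine ⟨ih.2, ?_⟩
    rw [klQ]
    refine MvPolynomial.IsHomogeneous.sub ?_ ?_
    · have := (klE_hom x).mul ih.2
      rwa [show 1 + (k + 1) = k + 1 + 1 by ring] at this
    · have := (MvPolynomial.isHomogeneous_C (Fin n) (klb n (k+1))).mul ((klN_hom n).mul ih.1)
      rwa [show 0 + (2 + k) = k + 1 + 1 by ring] at this

theorem klD_Q {n : ℕ} (hn : 3 ≤ n) (x : Fin n → ℝ) (hx : ∑ i, x i * x i = 1) (k : ℕ) :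
    klD x (klQ x (k+1)) = MvPolynomial.C (klb n (k+1) * (n + 2 * k)) * klQ x k ∧
    klD x (klQ x (k+2)) = MvPolynomial.C (klb n (k+2) * (n + 2 * (k+1))) * klQ x (k+1) := by
  have hn' : (3 : ℝ) ≤ n := by exact_mod_cast hn
  have hC2 : (MvPolynomial.C (2:ℝ) : MvPolynomial (Fin n) ℝ) = 2 := map_ofNat _ 2
  have h0 : klD x (klQ x 1) = 1 := by
    simp [klQ, klD_E, hx]
  have hb1 : klb n 1 * n = 1 := by
    unfold klb
    have : (n : ℝ) - 2 ≠ 0 := by linarith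
    have : (n : ℝ) ≠ 0 := by linarith
    push_cast
    rw [show (2 * 1 + (n:ℝ) - 2) = n by ring, show (2 * 1 + (n:ℝ) - 4) = n - 2 by ring,
      show (1 + (n:ℝ) - 3) = n - 2 by ring]
    field_simp
  have key : ∀ k : ℕ, 1 + klb n (k+1) * (n + 2 * k - 2) = klb n (k+2) * (n + 2 * (k+1)) := by
    intro k
    have hk : (0:ℝ) ≤ k := by positivity
    unfold klb
    push_cast
    have h1 : (2 * (k:ℝ) + n) ≠ 0 := by linarith
    have h2 : (2 * (k:ℝ) + n - 2) ≠ 0 := by linarith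
    have h3 : (2 * (k:ℝ) + n + 2) ≠ 0 := by linarith
    rw [show (2 * ((k:ℝ)+1) + n - 2) = 2 * k + n by ring,
      show (2 * ((k:ℝ)+1) + n - 4) = 2 * k + n - 2 by ring,
      show (2 * ((k:ℝ)+2) + n - 2) = 2 * k + n + 2 by ring,
      show (2 * ((k:ℝ)+2) + n - 4) = 2 * k + n by ring,
      show ((n:ℝ) + 2 * k - 2) = 2 * k + n - 2 by ring,
      show ((n:ℝ) + 2 * (k + 1)) = 2 * k + n + 2 by ring]
    rw [div_mul_eq_mul_div, mul_div_mul_right _ _ h2, div_mul_eq_mul_div,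
      mul_comm (2 * (k:ℝ) + n + 2) (2 * k + n), mul_div_mul_right _ _ h3, eq_div_iff h1, add_mul,
      div_mul_cancel₀ _ h1]
    ring
  induction k with
  | zero =>
    have h1 : klD x (klQ x 1) = MvPolynomial.C (klb n (0 + 1) * (n + 2 * ((0:ℕ):ℝ))) * klQ x 0 := by
      rw [h0]; simp [hb1, klQ]
    refine ⟨h1, ?_⟩
    have := key 0
    rw [show klQ x (0+2) = klE x * klQ x (0 + 1) - MvPolynomial.C (klb n (0 + 1)) * (klN n * klQ x 0) from rfl,
      klD_sub, klD_mul, klD_C_mul, klD_mul, klD_N, klD_E, hx]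
    rw [show klD x (klQ x (0+1)) = _ from h1]
    simp only [klQ, klD] 
    simp only [MvPolynomial.pderiv_one, mul_zero, Finset.sum_const_zero]
    rw [← this]
    simp [hC2]
    ring
  | succ k ih =>
    refine ⟨by simpa using ih.2, ?_⟩
    have := key (k+1)
    rw [klQ, klD_sub, klD_mul, klD_C_mul, klD_mul, klD_N, klD_E, hx]
    rw [ih.2, ih.1]
    push_cast at this ⊢
    rw [← this]
    have e : klQ x (k+2) = klE x * klQ x (k + 1) - MvPolynomial.C (klb n (k + 1)) * (klN n * klQ x k) := by
      rw [klQ]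
    rw [e]
    simp only [map_mul, map_add, map_sub, map_one, hC2]
    ring_nf

theorem klL_Q {n : ℕ} (hn : 3 ≤ n) (x : Fin n → ℝ) (hx : ∑ i, x i * x i = 1) (k : ℕ) :
    klL (klQ x k) = 0 ∧ klL (klQ x (k+1)) = 0 := by
  induction k with
  | zero => constructor <;> simp [klQ, klL, pderiv_klE]
  | succ k ih =>
    refine ⟨ih.2, ?_⟩
    rw [klQ, klL_sub, klL_C_mul, klL_E_mul, klL_N_mul _ k (klQ_hom x k).1, ih.1, ih.2,
      (klD_Q hn x hx k).1]
    have hC2 : (MvPolynomial.C (2:ℝ) : MvPolynomial (Fin n) ℝ) = 2 := map_ofNat _ 2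
    have hC4 : (MvPolynomial.C (4:ℝ) : MvPolynomial (Fin n) ℝ) = 4 := map_ofNat _ 4
    simp [hC2, hC4]
    ring

theorem klQ_eq {n : ℕ} (x : Fin n → ℝ) (k : ℕ) :
    (∃ r, klQ x k = klE x ^ k + klN n * r) ∧ (∃ r, klQ x (k+1) = klE x ^ (k+1) + klN n * r) := by
  induction k with
  | zero => exact ⟨⟨0, by simp [klQ]⟩, ⟨0, by simp [klQ]⟩⟩
  | succ k ih =>
    refine ⟨ih.2, ?_⟩
    obtain ⟨r, hr⟩ := ih.2
    refine ⟨klE x * r - MvPolynomial.C (klb n (k + 1)) * klQ x k, ?_⟩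
    rw [klQ, hr]
    ring

theorem klD_E_pow {n : ℕ} (x y : Fin n → ℝ) (k : ℕ) :
    klD x (klE y ^ (k+1)) = MvPolynomial.C ((k + 1) * ∑ i, x i * y i) * klE y ^ k := by
  induction k with
  | zero => simp [klD_E]
  | succ k ih =>
    rw [pow_succ, klD_mul, ih, klD_E]
    simp
    ring

theorem klL_E_pow {n : ℕ} (y : Fin n → ℝ) (hy : ∑ i, y i * y i = 1) (k : ℕ) :
    klL (klE y ^ (k+2)) = MvPolynomial.C ((k + 2) * (k + 1) : ℝ) * klE y ^ k := by
  have h : ∀ k : ℕ, klL (klE y ^ (k+1)) = MvPolynomial.C ((k + 1) * k : ℝ) * klE y ^ (k - 1) := by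
    intro k
    induction k with
    | zero => simp [klL, pderiv_klE]
    | succ k ih =>
      rw [pow_succ', klL_E_mul, ih, klD_E_pow, hy]
      rcases k with _ | k
      · simp; norm_num
      · simp
        ring
  have := h (k+1)
  simp only [Nat.add_sub_cancel] at this
  rw [show k + 2 = k + 1 + 1 by ring, this]
  push_cast
  congr 2
  ring

theorem klB_E_pow_Q {n : ℕ} (x y : Fin n → ℝ) (hy : ∑ i, y i * y i = 1) (k : ℕ) :
    klB n (klQ x k) (klE y ^ k) = k.factorial * klG n (∑ i, x i * y i) k ∧
    klB n (klQ x (k+1)) (klE y ^ (k+1)) = (k+1).factorial * klG n (∑ i, x i * y i) (k+1) := by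
  have h1 : klB n 1 1 = 1 := by
    have := klB_monomial (n := n) 0 1 1
    simpa [klW] using this
  induction k with
  | zero =>
    refine ⟨by simp [klQ, klG, h1], ?_⟩
    have := klB_E_mul x 1 (klE y)
    rw [klD_E] at this
    simp only [zero_add, klQ, klG, pow_one]
    rw [mul_one] at this
    rw [this, show (MvPolynomial.C (∑ i, x i * y i) : MvPolynomial (Fin n) ℝ)
      = (∑ i, x i * y i) • 1 by rw [MvPolynomial.smul_eq_C_mul, mul_one], map_smul, h1]
    simp
  | succ k ih =>
    refine ⟨ih.2, ?_⟩
    rw [klQ, klG, map_sub, LinearMap.sub_apply, ← MvPolynomial.smul_eq_C_mul, map_smul,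
      LinearMap.smul_apply, klB_E_mul, klB_N_mul, klD_E_pow, klL_E_pow y hy,
      ← MvPolynomial.smul_eq_C_mul, ← MvPolynomial.smul_eq_C_mul, map_smul, map_smul, ih.1, ih.2]
    simp only [smul_eq_mul, Nat.factorial_succ]
    push_cast
    ring

theorem klB_Q_Q {n : ℕ} (hn : 3 ≤ n) (x y : Fin n → ℝ) (hx : ∑ i, x i * x i = 1)
    (hy : ∑ i, y i * y i = 1) (k : ℕ) :
    klB n (klQ x k) (klQ y k) = k.factorial * klG n (∑ i, x i * y i) k := by
  obtain ⟨r, hr⟩ := (klQ_eq y k).1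
  rw [hr, map_add, (klB_E_pow_Q x y hy k).1, klB_symm, klB_N_mul, (klL_Q hn x hx k).1]
  simp

theorem klB_hom {n : ℕ} (k : ℕ) (p q : MvPolynomial (Fin n) ℝ) (hp : p.IsHomogeneous k) :
    klB n p q = ∑ α ∈ Finset.finsuppAntidiag (Finset.univ : Finset (Fin n)) k,
      p.coeff α * klW α * q.coeff α := by
  conv_lhs => rw [p.as_sum]
  rw [map_sum, LinearMap.sum_apply]
  simp only [klB_monomial]
  refine Finset.sum_subset ?_ ?_
  · intro α hα
    rw [MvPolynomial.mem_support_iff] at hα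
    have := hp hα
    rw [Finset.mem_finsuppAntidiag]
    refine ⟨?_, by simp⟩
    rw [← this]
    simp [Finsupp.weight_apply, Finsupp.sum_fintype]
  · intro α _ h
    rw [MvPolynomial.notMem_support_iff] at h
    simp [h]

/-- Feature map -/
theorem klG_feature {n : ℕ} (hn : 3 ≤ n) (k : ℕ) : ∃ v : (Fin n → ℝ) → (Fin n →₀ ℕ) → ℝ,
    ∀ x y : Fin n → ℝ, ∑ i, x i * x i = 1 → ∑ i, y i * y i = 1 →
    klG n (∑ i, x i * y i) k = 
      ∑ α ∈ Finset.finsuppAntidiag (Finset.univ : Finset (Fin n)) k, v x α * v y α := by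
  refine ⟨fun x α => Real.sqrt (klW α / k.factorial) * (klQ x k).coeff α, ?_⟩
  intro x y hx hy
  have h := klB_Q_Q hn x y hx hy k
  rw [klB_hom k _ _ (klQ_hom x k).1] at h
  have hk : (k.factorial : ℝ) ≠ 0 := by positivity
  have : klG n (∑ i, x i * y i) k = (k.factorial : ℝ)⁻¹ * (k.factorial * klG n (∑ i, x i * y i) k) := by
    field_simp
  rw [this, ← h, Finset.mul_sum]
  refine Finset.sum_congr rfl fun α _ => ?_
  have h2 := Real.mul_self_sqrt (show 0 ≤ klW α / k.factorial from
    div_nonneg (klW_pos α).le (by positivity))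
  calc _ = (klW α / k.factorial) * ((klQ x k).coeff α * (klQ y k).coeff α) := by
        field_simp
    _ = _ := by rw [← h2]; ring

theorem klG_one_pos {n : ℕ} (hn : 3 ≤ n) (k : ℕ) :
    0 < klG n 1 k ∧ klG n 1 (k+1) = ((k:ℝ) + n - 2) / (2 * k + n - 2) * klG n 1 k := by
  have hn' : (3 : ℝ) ≤ n := by exact_mod_cast hn
  induction k with
  | zero =>
    refine ⟨by simp [klG], ?_⟩
    have : (n : ℝ) - 2 ≠ 0 := by linarith
    simp [klG, this]
  | succ k ih =>
    obtain ⟨h1, h2⟩ := ih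
    have hk : (0:ℝ) ≤ k := by positivity
    have a1 : 0 < (k:ℝ) + n - 2 := by linarith
    have a2 : 0 < 2 * (k:ℝ) + n - 2 := by linarith
    have a3 : 0 < 2 * (k:ℝ) + n := by linarith
    have hp : 0 < klG n 1 (k+1) := by rw [h2]; positivity
    refine ⟨hp, ?_⟩
    rw [klG, h2]
    unfold klb
    push_cast
    rw [show (2 * ((k:ℝ)+1) + n - 2) = 2 * k + n by ring,
      show (2 * ((k:ℝ)+1) + n - 4) = 2 * k + n - 2 by ring,
      show ((k:ℝ) + 1 + n - 3) = k + n - 2 by ring,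
      show ((k:ℝ) + 1 + n - 2) = k + n - 1 by ring]
    generalize (2 * (k:ℝ) + n - 2) = M at a2
    have hM : 2 * (k:ℝ) + n = ((k:ℝ) + n - 1) + (k + 1) := by ring
    have a4 : 0 < ((k:ℝ) + n - 1) + (k + 1) := by linarith
    rw [hM]
    field_simp
    ring

theorem kl_schur {n : ℕ} (hn : 3 ≤ n) {ι : Type*} (A : Finset ι) (x : ι → Fin n → ℝ)
    (hx : ∀ a ∈ A, ∑ i, x a i * x a i = 1) (k l : ℕ) :
    0 ≤ ∑ a ∈ A, ∑ b ∈ A, klG n (∑ i, x a i * x b i) k * klG n (∑ i, x a i * x b i) l := by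
  obtain ⟨v, hv⟩ := klG_feature hn k
  obtain ⟨w, hw⟩ := klG_feature hn l
  have : ∑ a ∈ A, ∑ b ∈ A, klG n (∑ i, x a i * x b i) k * klG n (∑ i, x a i * x b i) l
      = ∑ α ∈ Finset.finsuppAntidiag (Finset.univ : Finset (Fin n)) k,
        ∑ β ∈ Finset.finsuppAntidiag (Finset.univ : Finset (Fin n)) l,
          (∑ a ∈ A, v (x a) α * w (x a) β) ^ 2 := by
    simp only [sq, Finset.sum_mul_sum]
    have : ∀ a ∈ A, ∀ b ∈ A,
        klG n (∑ i, x a i * x b i) k * klG n (∑ i, x a i * x b i) l =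
        ∑ α ∈ Finset.finsuppAntidiag (Finset.univ : Finset (Fin n)) k,
        ∑ β ∈ Finset.finsuppAntidiag (Finset.univ : Finset (Fin n)) l,
          v (x a) α * w (x a) β * (v (x b) α * w (x b) β) := by
      intro a ha b hb
      rw [hv _ _ (hx a ha) (hx b hb), hw _ _ (hx a ha) (hx b hb), Finset.sum_mul_sum]
      exact Finset.sum_congr rfl fun α _ => Finset.sum_congr rfl fun β _ => by ring
    rw [Finset.sum_congr rfl fun a ha => Finset.sum_congr rfl fun b hb => this a ha b hb]
    rw [Finset.sum_congr rfl fun a _ => Finset.sum_comm, Finset.sum_comm]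
    refine Finset.sum_congr rfl fun α _ => ?_
    rw [Finset.sum_congr rfl fun a _ => Finset.sum_comm, Finset.sum_comm]
  rw [this]
  positivity

theorem kl_trace {n : ℕ} (hn : 3 ≤ n) {ι : Type*} (A : Finset ι) (x : ι → Fin n → ℝ)
    (hx : ∀ a ∈ A, ∑ i, x a i * x a i = 1) (k : ℕ) :
    (A.card * klG n 1 k) ^ 2 ≤
      (Finset.finsuppAntidiag (Finset.univ : Finset (Fin n)) k).card *
      ∑ a ∈ A, ∑ b ∈ A, klG n (∑ i, x a i * x b i) k * klG n (∑ i, x a i * x b i) k := by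
  obtain ⟨v, hv⟩ := klG_feature hn k
  set I := Finset.finsuppAntidiag (Finset.univ : Finset (Fin n)) k
  have h1 : ∑ a ∈ A, ∑ b ∈ A, klG n (∑ i, x a i * x b i) k * klG n (∑ i, x a i * x b i) k
      = ∑ α ∈ I, ∑ β ∈ I, (∑ a ∈ A, v (x a) α * v (x a) β) ^ 2 := by
    simp only [sq, Finset.sum_mul_sum]
    have : ∀ a ∈ A, ∀ b ∈ A,
        klG n (∑ i, x a i * x b i) k * klG n (∑ i, x a i * x b i) k =
        ∑ α ∈ I, ∑ β ∈ I, v (x a) α * v (x a) β * (v (x b) α * v (x b) β) := by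
      intro a ha b hb
      rw [hv _ _ (hx a ha) (hx b hb), Finset.sum_mul_sum]
      exact Finset.sum_congr rfl fun α _ => Finset.sum_congr rfl fun β _ => by ring
    rw [Finset.sum_congr rfl fun a ha => Finset.sum_congr rfl fun b hb => this a ha b hb]
    rw [Finset.sum_congr rfl fun a _ => Finset.sum_comm, Finset.sum_comm]
    refine Finset.sum_congr rfl fun α _ => ?_
    rw [Finset.sum_congr rfl fun a _ => Finset.sum_comm, Finset.sum_comm]
  have h2 : A.card * klG n 1 k = ∑ α ∈ I, ∑ a ∈ A, v (x a) α * v (x a) α := by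
    rw [Finset.sum_comm, ← nsmul_eq_mul, ← Finset.sum_const]
    refine Finset.sum_congr rfl fun a ha => ?_
    rw [← hv _ _ (hx a ha) (hx a ha), hx a ha]
  rw [h1, h2]
  refine (sq_sum_le_card_mul_sum_sq).trans ?_
  gcongr with α hα
  exact Finset.single_le_sum (f := fun β => (∑ a ∈ A, v (x a) α * v (x a) β) ^ 2)
    (fun β _ => sq_nonneg _) hα

theorem kl_window {n : ℕ} (u s : ℝ) (a m : ℕ) (h : ℕ → ℝ) (h0 : h 0 = 0) (hm : h (m+1) = 0) :
    (u - s) * ∑ j ∈ Finset.range m, h (j+1) * klG n u (a+j+1) =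
      h 1 * klb n (a+1) * klG n u a + h m * klG n u (a+m+1) +
      ∑ j ∈ Finset.range m, (h j + klb n (a+j+2) * h (j+2) - s * h (j+1)) * klG n u (a+j+1) := by
  have e1 : ∑ j ∈ Finset.range m, h (j+1) * klG n u (a+j+2) =
      ∑ j ∈ Finset.range m, h j * klG n u (a+j+1) + h m * klG n u (a+m+1) := by
    have := Finset.sum_range_succ' (fun j => h j * klG n u (a+j+1)) m
    rw [Finset.sum_range_succ] at this
    rw [this, h0]
    simp
    exact Finset.sum_congr rfl fun j _ => by ring_nf
  have e2 : ∑ j ∈ Finset.range m, h (j+1) * klb n (a+j+1) * klG n u (a+j) =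
      ∑ j ∈ Finset.range m, klb n (a+j+2) * h (j+2) * klG n u (a+j+1) +
        h 1 * klb n (a+1) * klG n u a := by
    have := Finset.sum_range_succ' (fun j => h (j+1) * klb n (a+j+1) * klG n u (a+j)) m
    rw [Finset.sum_range_succ, hm] at this
    simp only [zero_mul, add_zero, zero_add] at this
    rw [this]
    congr 1
    exact Finset.sum_congr rfl fun j _ => by ring_nf
  have e3 : (u - s) * ∑ j ∈ Finset.range m, h (j+1) * klG n u (a+j+1) =
      ∑ j ∈ Finset.range m, h (j+1) * klG n u (a+j+2) +
      ∑ j ∈ Finset.range m, h (j+1) * klb n (a+j+1) * klG n u (a+j) -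
      ∑ j ∈ Finset.range m, s * h (j+1) * klG n u (a+j+1) := by
    rw [Finset.mul_sum, ← Finset.sum_add_distrib, ← Finset.sum_sub_distrib]
    refine Finset.sum_congr rfl fun j _ => ?_
    have : klG n u (a+j+2) = u * klG n u (a+j+1) - klb n (a+j+1) * klG n u (a+j) := by rw [klG]
    rw [this]; ring
  rw [e3, e1, e2]
  simp only [sub_mul, add_mul, Finset.sum_add_distrib, Finset.sum_sub_distrib]
  ring

theorem kl_lp {n : ℕ} (hn : 3 ≤ n) {ι : Type*} (A : Finset ι) (x : ι → Fin n → ℝ)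
    (hx : ∀ a ∈ A, ∑ i, x a i * x a i = 1) (s δ : ℝ) (hs : s < 1) (hδ : 0 < δ)
    (hA : ∀ a ∈ A, ∀ b ∈ A, a ≠ b → ∑ i, x a i * x b i ≤ s)
    (r m : ℕ) (hm1 : 1 ≤ m) (h : ℕ → ℝ) (h0 : h 0 = 0) (hm : h (m+1) = 0)
    (hpos : ∀ j, 1 ≤ j → j ≤ m → 0 < h j)
    (hb : ∀ k, r ≤ k → 0 ≤ klb n k)
    (hc : ∀ j < m, (s + δ) * h (j+1) ≤ h j + klb n (r+j+2) * h (j+2))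
    (D : ℝ)
    (hD : ∀ k ≤ r + m, ((Finset.finsuppAntidiag (Finset.univ : Finset (Fin n)) k).card : ℝ) ≤ D) :
    A.card * δ ≤ D * m * (1 - s) := by
  have hD0 : 0 ≤ D := le_trans (by positivity) (hD 0 (by omega))
  rcases A.eq_empty_or_nonempty with rfl | hne
  · simp only [Finset.card_empty, Nat.cast_zero, zero_mul]
    have : 0 ≤ 1 - s := by linarith
    positivity
  set U : ι → ι → ℝ := fun a b => ∑ i, x a i * x b i with hU
  set g : ℝ → ℝ := fun u => ∑ j ∈ Finset.range m, h (j+1) * klG n u (r+j+1) with hg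
  set c : ℕ → ℝ := fun j => h j + klb n (r+j+2) * h (j+2) - s * h (j+1) with hcdef
  set S : ℕ → ℕ → ℝ := fun k l => ∑ a ∈ A, ∑ b ∈ A, klG n (U a b) k * klG n (U a b) l with hS
  have hS0 : ∀ k l, 0 ≤ S k l := fun k l => kl_schur hn A x hx k l
  have hhp : ∀ j < m, 0 < h (j+1) := fun j hj => hpos (j+1) (by omega) (by omega)
  have hcp : ∀ j < m, δ * h (j+1) ≤ c j := fun j hj => by
    have := hc j hj
    simp only [hcdef]; linarith
  have hcp0 : ∀ j < m, 0 ≤ c j := fun j hj =>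
    le_trans (mul_nonneg hδ.le (hhp j hj).le) (hcp j hj)
  have hg1 : 0 < g 1 := by
    refine Finset.sum_pos (fun j hj => mul_pos (hhp j (Finset.mem_range.1 hj)) (klG_one_pos hn _).1) ?_
    exact ⟨0, by simp; omega⟩
  have hcard : (0:ℝ) < A.card := by exact_mod_cast hne.card_pos
  -- upper bound
  have upper : ∑ a ∈ A, ∑ b ∈ A, (U a b - s) * g (U a b) * g (U a b)
      ≤ A.card * ((1 - s) * g 1 ^ 2) := by
    rw [← nsmul_eq_mul, ← Finset.sum_const]
    refine Finset.sum_le_sum fun a ha => ?_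
    classical
    rw [← Finset.add_sum_erase _ _ ha]
    have e : U a a = 1 := hx a ha
    rw [e]
    have : ∑ b ∈ A.erase a, (U a b - s) * g (U a b) * g (U a b) ≤ 0 := by
      refine Finset.sum_nonpos fun b hb => ?_
      have h1 := hA a ha b (Finset.mem_of_mem_erase hb) (Finset.ne_of_mem_erase hb).symm
      rw [mul_assoc]
      exact mul_nonpos_of_nonpos_of_nonneg (by simp only [hU]; linarith) (mul_self_nonneg _)
    linarith
  -- expansion
  have hgS : ∀ k, ∑ a ∈ A, ∑ b ∈ A, klG n (U a b) k * g (U a b)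
      = ∑ l ∈ Finset.range m, h (l+1) * S k (r+l+1) := by
    intro k
    simp only [hg, hS, Finset.mul_sum]
    rw [Finset.sum_congr rfl fun a _ => Finset.sum_comm, Finset.sum_comm]
    exact Finset.sum_congr rfl fun l _ => Finset.sum_congr rfl fun a _ =>
      Finset.sum_congr rfl fun b _ => by ring
  have hgS0 : ∀ k, 0 ≤ ∑ a ∈ A, ∑ b ∈ A, klG n (U a b) k * g (U a b) := by
    intro k
    rw [hgS]
    exact Finset.sum_nonneg fun l hl => mul_nonneg (hhp l (Finset.mem_range.1 hl)).le (hS0 _ _)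
  have expand : ∑ a ∈ A, ∑ b ∈ A, (U a b - s) * g (U a b) * g (U a b) =
      h 1 * klb n (r+1) * (∑ a ∈ A, ∑ b ∈ A, klG n (U a b) r * g (U a b)) +
      h m * (∑ a ∈ A, ∑ b ∈ A, klG n (U a b) (r+m+1) * g (U a b)) +
      ∑ j ∈ Finset.range m, c j * (∑ a ∈ A, ∑ b ∈ A, klG n (U a b) (r+j+1) * g (U a b)) := by
    have : ∀ a b, (U a b - s) * g (U a b) * g (U a b) =
        h 1 * klb n (r+1) * (klG n (U a b) r * g (U a b)) +
        h m * (klG n (U a b) (r+m+1) * g (U a b)) +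
        ∑ j ∈ Finset.range m, c j * (klG n (U a b) (r+j+1) * g (U a b)) := by
      intro a b
      have := kl_window (n := n) (U a b) s r m h h0 hm
      change (U a b - s) * g (U a b) = _ at this
      rw [this, add_mul, add_mul, Finset.sum_mul]
      simp only [hcdef, mul_assoc]
    simp only [this, Finset.sum_add_distrib, Finset.mul_sum]
    congr 1
    rw [Finset.sum_congr rfl fun a _ => Finset.sum_comm, Finset.sum_comm]
  have lower : ∑ j ∈ Finset.range m, δ * (h (j+1)) ^ 2 * S (r+j+1) (r+j+1) ≤
      ∑ a ∈ A, ∑ b ∈ A, (U a b - s) * g (U a b) * g (U a b) := by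
    rw [expand]
    have t1 : 0 ≤ h 1 * klb n (r+1) * (∑ a ∈ A, ∑ b ∈ A, klG n (U a b) r * g (U a b)) :=
      mul_nonneg (mul_nonneg (hpos 1 le_rfl hm1).le (hb _ (by omega))) (hgS0 _)
    have t2 : 0 ≤ h m * (∑ a ∈ A, ∑ b ∈ A, klG n (U a b) (r+m+1) * g (U a b)) :=
      mul_nonneg (hpos m hm1 le_rfl).le (hgS0 _)
    have t3 : ∑ j ∈ Finset.range m, δ * (h (j+1)) ^ 2 * S (r+j+1) (r+j+1) ≤
        ∑ j ∈ Finset.range m, c j * (∑ a ∈ A, ∑ b ∈ A, klG n (U a b) (r+j+1) * g (U a b)) := by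
      refine Finset.sum_le_sum fun j hj => ?_
      have hj' := Finset.mem_range.1 hj
      rw [hgS]
      have q1 : h (j+1) * S (r+j+1) (r+j+1) ≤
          ∑ l ∈ Finset.range m, h (l+1) * S (r+j+1) (r+l+1) :=
        Finset.single_le_sum (f := fun l => h (l+1) * S (r+j+1) (r+l+1))
          (fun l hl => mul_nonneg (hhp l (Finset.mem_range.1 hl)).le (hS0 _ _)) hj
      calc δ * (h (j+1)) ^ 2 * S (r+j+1) (r+j+1)
          = (δ * h (j+1)) * (h (j+1) * S (r+j+1) (r+j+1)) := by ring
        _ ≤ c j * (h (j+1) * S (r+j+1) (r+j+1)) :=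
          mul_le_mul_of_nonneg_right (hcp j hj') (mul_nonneg (hhp j hj').le (hS0 _ _))
        _ ≤ _ := mul_le_mul_of_nonneg_left q1 (hcp0 j hj')
    linarith
  have tr : ∀ j < m, (A.card * klG n 1 (r+j+1)) ^ 2 ≤ D * S (r+j+1) (r+j+1) := by
    intro j hj
    refine (kl_trace hn A x hx (r+j+1)).trans ?_
    exact mul_le_mul_of_nonneg_right (hD _ (by omega)) (hS0 _ _)
  have cs : g 1 ^ 2 ≤ m * ∑ j ∈ Finset.range m, (h (j+1) * klG n 1 (r+j+1)) ^ 2 := by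
    have := sq_sum_le_card_mul_sum_sq (s := Finset.range m)
      (f := fun j => h (j+1) * klG n 1 (r+j+1))
    simpa using this
  have fin1 : A.card ^ 2 * δ * g 1 ^ 2 ≤ D * m * (A.card * ((1 - s) * g 1 ^ 2)) := by
    calc A.card ^ 2 * δ * g 1 ^ 2
        ≤ A.card ^ 2 * δ * (m * ∑ j ∈ Finset.range m, (h (j+1) * klG n 1 (r+j+1)) ^ 2) := by
          gcongr
      _ = m * ∑ j ∈ Finset.range m, δ * h (j+1) ^ 2 * (A.card * klG n 1 (r+j+1)) ^ 2 := by
          simp only [Finset.mul_sum]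
          exact Finset.sum_congr rfl fun j _ => by ring
      _ ≤ m * ∑ j ∈ Finset.range m, δ * h (j+1) ^ 2 * (D * S (r+j+1) (r+j+1)) := by
          gcongr with j hj
          exact tr j (Finset.mem_range.1 hj)
      _ = D * m * ∑ j ∈ Finset.range m, δ * (h (j+1)) ^ 2 * S (r+j+1) (r+j+1) := by
          simp only [Finset.mul_sum]
          exact Finset.sum_congr rfl fun j _ => by ring
      _ ≤ _ := by
          gcongr
          exact lower.trans upper
  have hq : 0 < A.card * g 1 ^ 2 := by positivity
  refine le_of_mul_le_mul_right ?_ hq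
  calc _ = A.card ^ 2 * δ * g 1 ^ 2 := by ring
    _ ≤ _ := fin1
    _ = _ := by ring

theorem klb_lower {n k : ℕ} (hn : 5 ≤ n) (ρ : ℝ) (hρ : 0 < ρ) (hk : ρ * n ≤ k) :
    (1 - (1 / (1 + 2 * ρ)) ^ 2) / 4 ≤ klb n k := by
  have hn' : (5 : ℝ) ≤ n := by exact_mod_cast hn
  have hk0 : (0:ℝ) ≤ k := by positivity
  unfold klb
  have hden : 0 < (2 * (k:ℝ) + n - 2) * (2 * k + n - 4) :=
    mul_pos (by linarith) (by linarith)
  have hq : 0 < (1 + 2 * ρ) ^ 2 := by positivity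
  rw [show (1 - (1 / (1 + 2 * ρ)) ^ 2) / 4 = ((1 + 2 * ρ) ^ 2 - 1) / (4 * (1 + 2 * ρ) ^ 2) by
    field_simp, div_le_div_iff₀ (by positivity) hden]
  -- let M = n - 3, P = 2k + M
  have key : ((1 + 2 * ρ) * (n - 3)) ≤ 2 * k + n - 3 := by nlinarith
  have key2 : ((1 + 2 * ρ) * (n - 3)) ^ 2 ≤ (2 * k + n - 3) ^ 2 := by
    have : (0:ℝ) ≤ (1 + 2 * ρ) * (n - 3) := mul_nonneg (by linarith) (by linarith)
    gcongr
  have : (1:ℝ) ≤ (1 + 2 * ρ) ^ 2 := by nlinarith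
  nlinarith

theorem kl_choose {n k K : ℕ} (ρ : ℝ) (hρ : 0 < ρ) (hk : k ≤ K) :
    ((Finset.finsuppAntidiag (Finset.univ : Finset (Fin n)) k).card : ℝ) ≤
      (1 + ρ) ^ n * ((1 + ρ) / ρ) ^ K := by
  rw [Finset.card_finsuppAntidiag_nat_eq_choose]
  simp only [Finset.card_univ, Fintype.card_fin]
  have h1 : (n + k - 1).choose k ≤ (n + k).choose k := Nat.choose_le_choose _ (by omega)
  have h2 : ((n + k).choose k : ℝ) * ρ ^ k ≤ (1 + ρ) ^ (n + k) := by
    rw [add_comm 1 ρ, add_pow]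
    have := Finset.single_le_sum (f := fun i => ρ ^ i * 1 ^ (n + k - i) * ((n+k).choose i : ℝ))
      (s := Finset.range (n + k + 1)) (fun i _ => by positivity)
      (Finset.mem_range.2 (show k < n + k + 1 by omega))
    simp only [one_pow, mul_one] at this ⊢
    linarith
  calc (((n + k - 1).choose k : ℕ) : ℝ) ≤ ((n + k).choose k : ℝ) := by exact_mod_cast h1
    _ ≤ (1 + ρ) ^ (n + k) / ρ ^ k := by rw [le_div_iff₀ (by positivity)]; exact h2
    _ = (1 + ρ) ^ n * ((1 + ρ) / ρ) ^ k := by rw [div_pow, pow_add]; ring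
    _ ≤ _ := by
      have : 1 ≤ (1 + ρ) / ρ := by rw [le_div_iff₀ hρ]; linarith
      gcongr

theorem kl_angle {n : ℕ} (t : ℝ) (ht₀ : 0 < t) (u v : EuclideanSpace ℝ (Fin n))
    (hu : u ≠ 0) (hv : v ≠ 0) (h : (1 + t) * max (‖u‖ ^ 2) (‖v‖ ^ 2) ≤ ‖u - v‖ ^ 2) :
    ∑ i, (u i / ‖u‖) * (v i / ‖v‖) ≤ (1 - t) / 2 := by
  have hu' : 0 < ‖u‖ := norm_pos_iff.2 hu
  have hv' : 0 < ‖v‖ := norm_pos_iff.2 hv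
  have e : ∑ i, (u i / ‖u‖) * (v i / ‖v‖) = inner ℝ u v / (‖u‖ * ‖v‖) := by
    rw [PiLp.inner_apply, Finset.sum_div]
    refine Finset.sum_congr rfl fun i _ => ?_
    simp
    field_simp
  rw [e, div_le_iff₀ (by positivity)]
  rw [norm_sub_sq_real] at h
  have h1 := le_trans (mul_le_mul_of_nonneg_left (le_max_left (‖u‖ ^ 2) (‖v‖ ^ 2))
    (by linarith : 0 ≤ 1 + t)) h
  have h2 := le_trans (mul_le_mul_of_nonneg_left (le_max_right (‖u‖ ^ 2) (‖v‖ ^ 2))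
    (by linarith : 0 ≤ 1 + t)) h
  rcases le_total ‖u‖ ‖v‖ with hle | hle
  · nlinarith [mul_nonneg hu'.le (sub_nonneg.2 hle), mul_nonneg (mul_nonneg ht₀.le hv'.le) (sub_nonneg.2 hle)]
  · nlinarith [mul_nonneg hv'.le (sub_nonneg.2 hle), mul_nonneg (mul_nonneg ht₀.le hu'.le) (sub_nonneg.2 hle)]

theorem kl_exists_m (s q : ℝ) (hs : s < q) (hq : 0 < q) :
    ∃ m : ℕ, 1 ≤ m ∧ s < q * Real.cos (Real.pi / (m + 1)) := by
  have h1 : Filter.Tendsto (fun m : ℕ => Real.pi / ((m : ℝ) + 1)) Filter.atTop (nhds 0) := by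
    have := (tendsto_one_div_add_atTop_nhds_zero_nat (𝕜 := ℝ)).const_mul Real.pi
    simpa [div_eq_mul_inv] using this
  have h2 : Filter.Tendsto (fun m : ℕ => q * Real.cos (Real.pi / ((m : ℝ) + 1))) Filter.atTop
      (nhds (q * Real.cos 0)) :=
    ((Real.continuous_cos.tendsto 0).comp h1).const_mul q
  rw [Real.cos_zero, mul_one] at h2
  obtain ⟨m, hm1, hm2⟩ := ((h2.eventually (lt_mem_nhds hs)).and (Filter.eventually_ge_atTop 1)).exists
  exact ⟨m, hm2, hm1⟩

set_option maxHeartbeats 1000000 in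
/-- For every `t ∈ (0, 1)` and `ε > 0` there is `n₀` such that for all
`n ≥ n₀`: if `A` is a finite set of nonzero vectors in `ℝⁿ` with
`‖u − v‖² ≥ (1 + t)·max(‖u‖², ‖v‖²)` for all distinct `u, v ∈ A`, then
`#A ≤ e^{(β(t) + ε)·n}`. -/
theorem stmt_10 (t : ℝ) (ht₀ : 0 < t) (ht₁ : t < 1) (ε : ℝ) (hε : 0 < ε) :
    ∃ n₀ : ℕ, ∀ n : ℕ, n₀ ≤ n →
      ∀ A : Finset (EuclideanSpace ℝ (Fin n)),
        (∀ u ∈ A, u ≠ 0) →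
        (∀ u ∈ A, ∀ v ∈ A, u ≠ v →
          (1 + t) * max (‖u‖ ^ 2) (‖v‖ ^ 2) ≤ ‖u - v‖ ^ 2) →
        (A.card : ℝ) ≤ Real.exp ((klBeta t + ε) * (n : ℝ)) := by
  set f := klSine t with hf
  have hff : f ^ 2 = 1 - ((1 - t) / 2) ^ 2 := by
    rw [hf, klSine, div_pow, Real.sq_sqrt (mul_nonneg (by linarith) (by linarith))]
    ring
  have hf0 : 0 < f := by
    rw [hf, klSine]
    have : 0 < (1 + t) * (3 - t) := mul_pos (by linarith) (by linarith)
    positivity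
  have hf1 : f < 1 := by nlinarith
  set s : ℝ := (1 - t) / 2 with hs
  have hs0 : 0 < s := by rw [hs]; linarith
  have hs1 : s < 1 := by rw [hs]; linarith
  set ρ : ℝ := (1 - f) / (2 * f) with hρdef
  have hρ : 0 < ρ := div_pos (by linarith) (by linarith)
  have hρ1 : (1 + f) / (2 * f) = 1 + ρ := by rw [hρdef]; field_simp; ring
  have hfρ : f = 1 / (1 + 2 * ρ) := by rw [hρdef]; field_simp; ring
  have hβ : klBeta t = (1 + ρ) * Real.log (1 + ρ) - ρ * Real.log ρ := by
    rw [klBeta, ← hf, hρ1]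
  set κ : ℝ := Real.log ((1 + ρ) / ρ) with hκdef
  have hκ : 0 < κ := Real.log_pos (by rw [lt_div_iff₀ hρ]; linarith)
  have hκ2 : κ = Real.log (1 + ρ) - Real.log ρ := Real.log_div (by positivity) hρ.ne'
  set η : ℝ := ε / 2 / κ with hη
  have hη0 : 0 < η := by positivity
  have hηκ : η * κ = ε / 2 := by rw [hη]; field_simp
  set ρ' : ℝ := ρ + η with hρ'
  have hρ'0 : 0 < ρ' := by positivity
  set f' : ℝ := 1 / (1 + 2 * ρ') with hf'
  have hf'0 : 0 < f' := by positivity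
  have hff' : f' < f := by
    rw [hfρ, hf']
    exact one_div_lt_one_div_of_lt (by positivity) (by linarith)
  set b : ℝ := (1 - f' ^ 2) / 4 with hb
  have hb0 : 0 < b := by rw [hb]; nlinarith
  set w : ℝ := Real.sqrt b with hw
  have hw0 : 0 < w := Real.sqrt_pos.2 hb0
  have hww : w ^ 2 = b := Real.sq_sqrt hb0.le
  have hsw : s < 2 * w := by
    have : s ^ 2 < (2 * w) ^ 2 := by
      rw [mul_pow, hww, hb]; nlinarith
    exact lt_of_pow_lt_pow_left₀ 2 (by positivity) this
  obtain ⟨m, hm1, hm⟩ := kl_exists_m s (2 * w) hsw (by positivity)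
  set φ : ℝ := Real.pi / (m + 1) with hφ
  have hφ0 : 0 < φ := by have := Real.pi_pos; positivity
  have hφm : (m + 1) * φ = Real.pi := by rw [hφ]; field_simp
  set δ : ℝ := 2 * w * Real.cos φ - s with hδ
  have hδ0 : 0 < δ := by rw [hδ]; linarith
  set h : ℕ → ℝ := fun j => (1 / w) ^ j * Real.sin (j * φ) with hh
  have h0 : h 0 = 0 := by simp [hh]
  have hhm : h (m+1) = 0 := by
    simp only [hh]; push_cast; rw [hφm]; simp
  have hpos : ∀ j, 1 ≤ j → j ≤ m → 0 < h j := by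
    intro j hj1 hj2
    have hj1' : (1:ℝ) ≤ j := by exact_mod_cast hj1
    have hj2' : (j:ℝ) ≤ m := by exact_mod_cast hj2
    refine mul_pos (by positivity) (Real.sin_pos_of_pos_of_lt_pi (by positivity) ?_)
    rw [← hφm]
    exact mul_lt_mul_of_pos_right (by linarith) hφ0
  have hrec : ∀ j, (s + δ) * h (j+1) = h j + b * h (j+2) := by
    intro j
    have e1 : Real.sin (j * φ) + Real.sin ((j + 2) * φ) =
        2 * Real.cos φ * Real.sin ((j + 1) * φ) := by
      rw [show (j : ℝ) * φ = (j + 1) * φ - φ by ring, show ((j:ℝ) + 2) * φ = (j + 1) * φ + φ by ring,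
        Real.sin_sub, Real.sin_add]
      ring
    have e2 : b * (1 / w) ^ (j + 2) = (1 / w) ^ j := by
      rw [← hww, pow_add]; field_simp
    have e3 : w * (1 / w) ^ (j + 1) = (1 / w) ^ j := by
      rw [pow_succ]; field_simp
    simp only [hh]
    push_cast
    calc (s + δ) * ((1 / w) ^ (j + 1) * Real.sin ((j + 1) * φ))
        = (w * (1 / w) ^ (j + 1)) * (2 * Real.cos φ * Real.sin ((j + 1) * φ)) := by
          rw [hδ]; ring
      _ = (1 / w) ^ j * Real.sin (j * φ) + (b * (1 / w) ^ (j + 2)) * Real.sin ((j + 2) * φ) := by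
          rw [e3, e2, ← e1]; ring
      _ = _ := by ring
  set K : ℝ := m * (1 - s) / δ * Real.exp ((m + 1) * κ) with hK
  refine ⟨max 5 ⌈2 * K / ε⌉₊, ?_⟩
  intro n hn A hA0 hA
  have hn5 : 5 ≤ n := le_trans (le_max_left _ _) hn
  have hnK : 2 * K / ε ≤ n := le_trans (Nat.le_ceil _) (by exact_mod_cast le_trans (le_max_right _ _) hn)
  set r : ℕ := ⌈ρ' * n⌉₊ with hr
  have hr1 : ρ' * n ≤ r := Nat.le_ceil _
  have hr2 : (r : ℝ) ≤ ρ' * n + 1 := (Nat.ceil_lt_add_one (by positivity)).le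
  have hbk : ∀ k, r ≤ k → b ≤ klb n k := by
    intro k hk
    exact klb_lower hn5 ρ' hρ'0 (hr1.trans (by exact_mod_cast hk))
  have hnn : ∀ j ≤ m + 1, 0 ≤ h j := by
    intro j hj
    rcases Nat.eq_zero_or_pos j with rfl | hj0
    · exact h0.ge
    · rcases Nat.lt_or_ge m j with hlt | hge
      · have : j = m + 1 := by omega
        rw [this, hhm]
      · exact (hpos j hj0 hge).le
  have main := kl_lp (n := n) (by omega) A (fun u i => u i / ‖u‖) (by
      intro u hu
      have hu' : 0 < ‖u‖ := norm_pos_iff.2 (hA0 u hu)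
      have : ‖u‖ ^ 2 = ∑ i, u i ^ 2 := EuclideanSpace.real_norm_sq_eq u
      have e : ∀ i, u i / ‖u‖ * (u i / ‖u‖) = u i ^ 2 / ‖u‖ ^ 2 := fun i => by ring
      simp only [e]
      rw [← Finset.sum_div, ← this, div_self (by positivity)])
    s δ hs1 hδ0 (by
      intro u hu v hv huv
      exact kl_angle t ht₀ u v (hA0 u hu) (hA0 v hv) (hA u hu v hv huv))
    r m hm1 h h0 hhm hpos (fun k hk => hb0.le.trans (hbk k hk)) (by
      intro j hj
      rw [hrec]
      have := mul_le_mul_of_nonneg_right (hbk (r + j + 2) (by omega)) (hnn (j+2) (by omega))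
      linarith)
    ((1 + ρ) ^ n * ((1 + ρ) / ρ) ^ (r + m)) (fun k hk => kl_choose ρ hρ hk)
  have hDexp : (1 + ρ) ^ n * ((1 + ρ) / ρ) ^ (r + m) ≤
      Real.exp ((m + 1) * κ) * Real.exp ((klBeta t + ε / 2) * n) := by
    have e1 : (1 + ρ) ^ n = Real.exp (n * Real.log (1 + ρ)) := by
      rw [Real.exp_nat_mul, Real.exp_log (by positivity)]
    have e2 : ((1 + ρ) / ρ) ^ (r + m) = Real.exp ((r + m : ℕ) * κ) := by
      rw [Real.exp_nat_mul, hκdef, Real.exp_log (by positivity)]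
    rw [e1, e2, ← Real.exp_add, ← Real.exp_add]
    refine Real.exp_le_exp.2 ?_
    push_cast
    have q1 : (r : ℝ) * κ ≤ (ρ' * n + 1) * κ := mul_le_mul_of_nonneg_right hr2 hκ.le
    have q2 : (ρ' * n + 1) * κ = ρ * κ * n + η * κ * n + κ := by rw [hρ']; ring
    have q3 : klBeta t = Real.log (1 + ρ) + ρ * κ := by rw [hβ, hκ2]; ring
    rw [q2, hηκ] at q1
    rw [q3]
    have q4 : (Real.log (1 + ρ) + ρ * κ + ε / 2) * (n:ℝ) =
        n * Real.log (1 + ρ) + ρ * κ * n + ε / 2 * n := by ring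
    rw [q4]
    linarith
  have hs1' : 0 ≤ 1 - s := by linarith
  have hKn : K ≤ Real.exp (ε / 2 * n) := by
    have h1 := Real.add_one_le_exp (ε / 2 * n)
    rw [div_le_iff₀ hε] at hnK
    linarith
  have hfin : (A.card : ℝ) ≤ K * Real.exp ((klBeta t + ε / 2) * n) := by
    rw [← le_div_iff₀ hδ0] at main
    refine main.trans ?_
    calc (1 + ρ) ^ n * ((1 + ρ) / ρ) ^ (r + m) * m * (1 - s) / δ
        = ((1 + ρ) ^ n * ((1 + ρ) / ρ) ^ (r + m)) * (m * (1 - s) / δ) := by ring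
      _ ≤ (Real.exp ((m + 1) * κ) * Real.exp ((klBeta t + ε / 2) * n)) * (m * (1 - s) / δ) := by
          gcongr
      _ = _ := by rw [hK]; ring
  calc (A.card : ℝ) ≤ K * Real.exp ((klBeta t + ε / 2) * n) := hfin
    _ ≤ Real.exp (ε / 2 * n) * Real.exp ((klBeta t + ε / 2) * n) := by gcongr
    _ = _ := by rw [← Real.exp_add]; congr 1; ring
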